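/- Define L(μ, τ) = −[ψ(μτ) − ψ(τ)] + λ·D_KL(Beta(μτ, (1−μ)τ) || Beta(α₀, β₀)) on (0,1) × (0,∞), with λ > 0 and α₀, β₀ > 0. Then L is continuous, finite at the point (μ₀, τ₀) = (α₀/(α₀+β₀), α₀+β₀), and every global minimizer (μ*, τ*) of L satisfies 0 < μ* < 1 and 0 < τ* < ∞ (i.e., the infimum is attained at an interior point). -/

import Mathlib

open Real Filter Asymptotics MeasureTheory Set

/-- The digamma function `ψ(x) = d/dx log Γ(x)`. -/
noncomputable def digamma (x : ℝ) : ℝ := deriv (fun y : ℝ => Real.log (Real.Gamma y)) x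

/-- The trigamma function `ψ₁ = ψ'`. -/
noncomputable def trigamma (x : ℝ) : ℝ := deriv digamma x

/-- Closed-form KL divergence between `Beta(a,b)` and `Beta(a₀,b₀)`. -/
noncomputable def betaKL (a b a0 b0 : ℝ) : ℝ :=
  Real.log (Real.Gamma (a + b) / (Real.Gamma a * Real.Gamma b)) -
    Real.log (Real.Gamma (a0 + b0) / (Real.Gamma a0 * Real.Gamma b0)) +
    (a - a0) * (digamma a - digamma (a + b)) +
    (b - b0) * (digamma b - digamma (a + b))

/-- The ICRM loss `L(μ,τ)`. -/
noncomputable def icrmLoss (lam a0 b0 μ τ : ℝ) : ℝ :=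
  -(digamma (μ * τ) - digamma τ) + lam * betaKL (μ * τ) ((1 - μ) * τ) a0 b0

namespace ICRM

/-- log Gamma -/
noncomputable def lG (x : ℝ) : ℝ := Real.log (Real.Gamma x)

lemma gdiff {x : ℝ} (hx : 0 < x) : DifferentiableAt ℝ Real.Gamma x :=
  Real.differentiableAt_Gamma fun m => by
    have : (0:ℝ) ≤ m := Nat.cast_nonneg m
    linarith

lemma lG_hasDeriv {x : ℝ} (hx : 0 < x) : HasDerivAt lG (digamma x) x :=
  ((gdiff hx).log (Real.Gamma_pos_of_pos hx).ne').hasDerivAt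

lemma lG_convex : ConvexOn ℝ (Ioi 0) lG := Real.convexOn_log_Gamma

lemma lG_rec {x : ℝ} (hx : 0 < x) : lG (x + 1) = lG x + Real.log x := by
  unfold lG
  rw [Real.Gamma_add_one hx.ne', Real.log_mul hx.ne' (Real.Gamma_pos_of_pos hx).ne', add_comm]

lemma psi_rec {x : ℝ} (hx : 0 < x) : digamma (x + 1) = digamma x + 1 / x := by
  have h1 : HasDerivAt (fun y => lG (y + 1)) (digamma (x + 1)) x :=
    (lG_hasDeriv (by linarith : 0 < x + 1)).comp_add_const x 1
  have h2 : HasDerivAt (fun y => lG y + Real.log y) (digamma x + x⁻¹) x :=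
    (lG_hasDeriv hx).add (Real.hasDerivAt_log hx.ne')
  have h3 : HasDerivAt (fun y => lG (y + 1)) (digamma x + x⁻¹) x := by
    refine h2.congr_of_eventuallyEq ?_
    filter_upwards [Ioi_mem_nhds hx] with y hy
    exact lG_rec hy
  rw [one_div]
  exact h1.unique h3

lemma psi_mono {x y : ℝ} (hx : 0 < x) (hxy : x ≤ y) : digamma x ≤ digamma y :=
  lG_convex.monotoneOn_deriv (fun z hz => (lG_hasDeriv hz).differentiableAt)
    (show x ∈ Ioi 0 from hx) (show y ∈ Ioi 0 from lt_of_lt_of_le hx hxy) hxy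

lemma psi_le {x : ℝ} (hx : 0 < x) : digamma x ≤ Real.log x := by
  have h := lG_convex.le_slope_of_hasDerivAt (show x ∈ Ioi 0 from hx)
    (show x + 1 ∈ Ioi 0 by simp only [mem_Ioi]; linarith) (by linarith) (lG_hasDeriv hx)
  rw [slope_def_field, lG_rec hx] at h
  simpa using h

lemma psi_ge {x : ℝ} (hx : 0 < x) : Real.log x - 1 / x ≤ digamma x := by
  have h := lG_convex.slope_le_of_hasDerivAt (show x ∈ Ioi 0 from hx)
    (show x + 1 ∈ Ioi 0 by simp only [mem_Ioi]; linarith) (by linarith)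
    (lG_hasDeriv (by linarith : 0 < x + 1))
  rw [slope_def_field, lG_rec hx, psi_rec hx] at h
  have h2 : (lG x + Real.log x - lG x) / (x + 1 - x) = Real.log x := by
    rw [add_sub_cancel_left, add_sub_cancel_left, div_one]
  linarith

lemma log_trap {u : ℝ} (hu : 1 ≤ u) : Real.log u ≤ (u - u⁻¹) / 2 := by
  rw [← Real.sinh_log (by linarith)]
  exact Real.self_le_sinh_iff.2 (Real.log_nonneg hu)

/-- the first correction -/
noncomputable def D (x : ℝ) : ℝ := digamma x - Real.log x + 1 / (2 * x)

lemma D_step {x : ℝ} (hx : 0 < x) : D x ≤ D (x + 1) := by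
  unfold D
  rw [psi_rec hx]
  have h := log_trap (u := (x + 1) / x) (by rw [le_div_iff₀ hx]; linarith)
  rw [Real.log_div (by linarith) hx.ne'] at h
  have e : ((x + 1) / x - ((x + 1) / x)⁻¹) / 2 = 1 / x + 1 / (2 * (x + 1)) - 1 / (2 * x) := by
    field_simp
    ring
  linarith

lemma D_le_add {x : ℝ} (hx : 0 < x) (n : ℕ) : D x ≤ D (x + n) := by
  induction n with
  | zero => simp
  | succ n ih =>
    refine ih.trans ?_
    have := D_step (x := x + n) (by positivity)
    push_cast
    rwa [← add_assoc]

lemma D_nonpos {x : ℝ} (hx : 0 < x) : D x ≤ 0 := by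
  by_contra! h
  obtain ⟨n, hn⟩ := exists_nat_gt (1 / (2 * D x))
  have h1 := D_le_add hx n
  have h2 : 0 < x + n := by positivity
  have h3 := psi_le h2
  have h4 : D x ≤ 1 / (2 * (x + n)) := by
    have : D (x + n) ≤ 1 / (2 * (x + n)) := by unfold D; linarith
    linarith
  rw [div_lt_iff₀ (by positivity)] at hn
  rw [le_div_iff₀ (by positivity)] at h4
  nlinarith [mul_pos hx h]

lemma D_ge {x : ℝ} (hx : 0 < x) : -(1/2) ≤ x * D x := by
  have h := psi_ge hx
  have : -(1 / (2 * x)) ≤ D x := by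
    unfold D
    have : 1 / x = 1 / (2 * x) + 1 / (2 * x) := by field_simp; norm_num
    linarith
  calc -(1/2) = x * (-(1 / (2 * x))) := by field_simp
    _ ≤ _ := by gcongr

/-- Stirling error -/
noncomputable def S (x : ℝ) : ℝ := lG x - (x - 1/2) * Real.log x + x

lemma S_hasDeriv {x : ℝ} (hx : 0 < x) : HasDerivAt S (D x) x := by
  have h := ((lG_hasDeriv hx).sub
    (((hasDerivAt_id x).sub_const (1/2)).mul (Real.hasDerivAt_log hx.ne'))).add (hasDerivAt_id x)
  refine h.congr_deriv ?_
  unfold D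
  simp only [id]
  field_simp
  ring

lemma S_anti : AntitoneOn S (Ioi 0) := by
  refine antitoneOn_of_deriv_nonpos (convex_Ioi 0)
    (fun x hx => (S_hasDeriv hx).continuousAt.continuousWithinAt) ?_ ?_
  · intro x hx
    rw [interior_Ioi] at hx
    exact (S_hasDeriv hx).differentiableAt.differentiableWithinAt
  · intro x hx
    rw [interior_Ioi] at hx
    rw [(S_hasDeriv hx).deriv]
    exact D_nonpos hx

lemma S_nat (n : ℕ) (hn : 0 < n) : 0 ≤ S n := by
  have hn' : (0:ℝ) < n := by exact_mod_cast hn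
  have h := Stirling.le_factorial_stirling n
  have h1 := Real.log_le_log (by positivity) h
  have h2 : lG n + Real.log n = Real.log (n.factorial) := by
    rw [← lG_rec hn']; unfold lG; rw [Real.Gamma_nat_eq_factorial]
  rw [Real.log_mul (by positivity) (by positivity), Real.log_pow,
    Real.log_div (by positivity) (by positivity), Real.log_exp, Real.log_sqrt (by positivity),
    Real.log_mul (by positivity) (by positivity)] at h1
  have h3 : 0 ≤ Real.log (2 * π) := Real.log_nonneg (by linarith [Real.pi_gt_three])
  unfold S
  linarith

lemma S_nonneg {x : ℝ} (hx : 0 < x) : 0 ≤ S x := by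
  obtain ⟨n, hn⟩ := exists_nat_gt x
  have hn' : (0:ℝ) < n := hx.trans hn
  exact (S_nat n (by exact_mod_cast hn')).trans (S_anti hx hn' hn.le)

lemma S_le {x : ℝ} (hx : 0 < x) : S x ≤ 2 - 1/2 * min (Real.log x) 0 := by
  rcases le_total x 1 with h1 | h1
  · have hl : Real.log x ≤ 0 := Real.log_nonpos hx.le h1
    rw [min_eq_left hl]
    have hc := lG_convex.2 (show (1:ℝ) ∈ Ioi 0 by simp) (show (2:ℝ) ∈ Ioi 0 by simp)
      (show 0 ≤ 1 - x by linarith) hx.le (by ring)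
    have e1 : lG 1 = 0 := by simp [lG]
    have e2 : lG 2 = 0 := by simp [lG]
    simp only [smul_eq_mul, e1, e2] at hc
    rw [show (1 - x) * 1 + x * 2 = x + 1 by ring, lG_rec hx] at hc
    have h5 : -(x * Real.log x) ≤ 1 := by
      have := Real.log_le_sub_one_of_pos (inv_pos.2 hx)
      rw [Real.log_inv] at this
      have h6 := mul_le_mul_of_nonneg_left this hx.le
      rw [mul_sub, mul_inv_cancel₀ hx.ne'] at h6
      linarith
    unfold S
    linarith
  · have hl : 0 ≤ Real.log x := Real.log_nonneg h1
    rw [min_eq_right hl]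
    have := S_anti (show (1:ℝ) ∈ Ioi 0 by simp) hx h1
    have e1 : S 1 = 1 := by simp [S, lG]
    linarith

noncomputable def g (x : ℝ) : ℝ := x * digamma x - lG x

lemma g_eq {x : ℝ} (hx : 0 < x) : g x = x + 1/2 * Real.log x - 1/2 + x * D x - S x := by
  unfold g S D
  field_simp
  ring

lemma g_le {x : ℝ} (hx : 0 < x) : g x ≤ x + 1/2 * Real.log x := by
  rw [g_eq hx]
  have := S_nonneg hx
  have := mul_nonpos_of_nonneg_of_nonpos hx.le (D_nonpos hx)
  linarith

lemma g_ge {x : ℝ} (hx : 0 < x) :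
    x + 1/2 * Real.log x + 1/2 * min (Real.log x) 0 - 3 ≤ g x := by
  rw [g_eq hx]
  have := S_le hx
  have := D_ge hx
  linarith

/-- lower bound for the entropy part -/
lemma G_ge {a b : ℝ} (ha : 0 < a) (hab : a ≤ b) :
    1/2 * Real.log a + min (Real.log a) 0 - 7 ≤ g a + g b - g (a + b) := by
  have hb : 0 < b := ha.trans_le hab
  have h1 := g_ge ha
  have h2 := g_ge hb
  have h3 := g_le (add_pos ha hb)
  have hm : min (Real.log a) 0 ≤ min (Real.log b) 0 :=
    min_le_min_right _ (Real.log_le_log ha hab)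
  have h4 : Real.log (a + b) ≤ Real.log 2 + Real.log b := by
    rw [← Real.log_mul (by norm_num) hb.ne']
    exact Real.log_le_log (by positivity) (by linarith)
  have h5 : Real.log 2 ≤ 1 := by linarith [Real.log_two_lt_d9]
  linarith

lemma Delta_small {a b : ℝ} (ha : 0 < a) (h1 : a ≤ 1) (hab : a ≤ b) :
    1 / (2 * a) + Real.log a - 1 ≤ digamma (a + b) - digamma a := by
  have h2 := psi_mono (by linarith : 0 < 2 * a) (by linarith : 2 * a ≤ a + b)
  have h3 := psi_ge (by linarith : 0 < 2 * a)
  have h4 := psi_le (by linarith : 0 < a + 1)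
  rw [psi_rec ha] at h4
  have h5 : Real.log (a + 1) ≤ Real.log 2 := Real.log_le_log (by linarith) (by linarith)
  have h6 : Real.log (2 * a) = Real.log 2 + Real.log a := Real.log_mul (by norm_num) ha.ne'
  have : 1 / a = 1 / (2 * a) + 1 / (2 * a) := by field_simp; norm_num
  linarith

/-- coercivity -/
lemma coercive (c M : ℝ) (hc : 0 < c) : ∃ δ > 0, ∃ R, ∀ a b : ℝ, 0 < a → a ≤ b →
    g a + g b - g (a + b) + c * (digamma (a + b) - digamma a) ≤ M → δ ≤ a ∧ b ≤ R := by
  obtain ⟨δ, hδ, hδ'⟩ : ∃ δ > 0, ∀ a b : ℝ, 0 < a → a ≤ b →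
    g a + g b - g (a + b) + c * (digamma (a + b) - digamma a) ≤ M → δ ≤ a := by
    set ε : ℝ := c / (4 * (3/2 + c)) with hε
    have hεp : 0 < ε := by positivity
    set K' : ℝ := max 1 (M + 7 + c - (3/2 + c) * (1 + Real.log ε)) with hK'
    have hKp : 0 < K' := lt_of_lt_of_le one_pos (le_max_left _ _)
    refine ⟨min 1 (c / (4 * K')), by positivity, fun a b ha hab h => ?_⟩
    rcases le_total 1 a with h1 | h1
    · exact (min_le_left _ _).trans h1
    refine (min_le_right _ _).trans ?_
    have hG := G_ge ha hab
    rw [min_eq_left (Real.log_nonpos ha.le h1)] at hG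
    have hD := mul_le_mul_of_nonneg_left (Delta_small ha h1 hab) hc.le
    have hl := Real.log_le_sub_one_of_pos (div_pos hεp ha)
    rw [Real.log_div hεp.ne' ha.ne'] at hl
    have hl2 := mul_le_mul_of_nonneg_left hl (by positivity : 0 ≤ 3/2 + c)
    have e1 : (3/2 + c) * (ε / a - 1) = c / (4 * a) - (3/2 + c) := by
      rw [hε]; field_simp
    have e2 : c * (1 / (2 * a) + Real.log a - 1)
      = c / (4 * a) + c / (4 * a) + c * Real.log a - c := by field_simp; ring
    rw [e1] at hl2
    rw [e2] at hD
    have : c / (4 * a) ≤ K' := by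
      refine le_trans ?_ (le_max_right _ _)
      linarith
    rw [div_le_iff₀ (by positivity)] at this ⊢
    linarith
  set B : ℝ := min (Real.log δ) 0 with hB
  set R₁ : ℝ := 2 * (M + 7 - B) with hR1
  set Q : ℝ := (M - (1/2 * Real.log δ + B - 7)) / c with hQ
  refine ⟨δ, hδ, Real.exp (Q + 1 / δ + R₁), fun a b ha hab h => ?_⟩
  have hd := hδ' a b ha hab h
  refine ⟨hd, ?_⟩
  have hb : 0 < b := ha.trans_le hab
  have hG := G_ge ha hab
  have hlog := Real.log_le_log hδ hd
  have hm : B ≤ min (Real.log a) 0 := min_le_min_right _ hlog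
  have hD0 : 0 ≤ digamma (a + b) - digamma a :=
    sub_nonneg.2 (psi_mono ha (by linarith))
  have hD1 := mul_nonneg hc.le hD0
  have ha1 : Real.log a ≤ R₁ := by linarith
  have hDQ : digamma (a + b) - digamma a ≤ Q := by
    rw [hQ, le_div_iff₀ hc]
    linarith
  have h1 := psi_mono hb (by linarith : b ≤ a + b)
  have h2 := psi_ge hb
  have h3 := psi_le ha
  have h4 : 1 / b ≤ 1 / δ := one_div_le_one_div_of_le hδ (hd.trans hab)
  rw [← Real.log_le_iff_le_exp hb]
  linarith

lemma psi_cont {x : ℝ} (hx : 0 < x) : ContinuousAt digamma x := by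
  have hU : IsOpen {z : ℂ | 0 < z.re} := isOpen_lt continuous_const Complex.continuous_re
  have hd : DifferentiableOn ℂ Complex.Gamma {z : ℂ | 0 < z.re} := by
    intro z hz
    refine (Complex.differentiableAt_Gamma z fun m h => ?_).differentiableWithinAt
    have h2 : 0 < z.re := hz
    rw [h] at h2
    simp at h2
    have : (0:ℝ) ≤ m := Nat.cast_nonneg m
    linarith
  have hc : ContinuousAt (deriv Complex.Gamma) (x : ℂ) :=
    ((hd.deriv hU).differentiableAt (hU.mem_nhds (by simpa using hx))).continuousAt
  have hr : ContinuousAt (fun y : ℝ => (deriv Complex.Gamma (y : ℂ)).re / Real.Gamma y) x := by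
    refine ContinuousAt.div ?_ (gdiff hx).continuousAt (Real.Gamma_pos_of_pos hx).ne'
    refine Complex.continuous_re.continuousAt.comp ?_
    exact ContinuousAt.comp (f := fun y : ℝ => (y : ℂ)) hc Complex.continuous_ofReal.continuousAt
  refine hr.congr ?_
  filter_upwards [Ioi_mem_nhds hx] with y hy
  have hy' : 0 < y := hy
  have h1 : HasDerivAt Complex.Gamma (deriv Complex.Gamma (y : ℂ)) (y : ℂ) :=
    (hd.differentiableAt (hU.mem_nhds (by simpa using hy'))).hasDerivAt
  have h2 : HasDerivAt Real.Gamma (deriv Complex.Gamma (y : ℂ)).re y := by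
    have := h1.real_of_complex
    simpa [Complex.Gamma_ofReal] using this
  exact ((h2.log (Real.Gamma_pos_of_pos hy').ne').unique (lG_hasDeriv hy'))

/-- loss in (a, b) coordinates -/
noncomputable def f (lam a0 b0 : ℝ) (p : ℝ × ℝ) : ℝ :=
  -(digamma p.1 - digamma (p.1 + p.2)) + lam * betaKL p.1 p.2 a0 b0

lemma f_cont (lam a0 b0 : ℝ) : ContinuousOn (f lam a0 b0) (Ioi 0 ×ˢ Ioi 0) := by
  rintro ⟨a, b⟩ ⟨ha, hb⟩
  simp only [mem_Ioi] at ha hb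
  apply ContinuousAt.continuousWithinAt
  have hab : 0 < a + b := add_pos ha hb
  have c1 : ContinuousAt (fun p : ℝ × ℝ => p.1) (a, b) := continuousAt_fst
  have c2 : ContinuousAt (fun p : ℝ × ℝ => p.2) (a, b) := continuousAt_snd
  have c3 : ContinuousAt (fun p : ℝ × ℝ => p.1 + p.2) (a, b) := c1.add c2
  have p1 : ContinuousAt (fun p : ℝ × ℝ => digamma p.1) (a, b) :=
    ContinuousAt.comp (f := fun p : ℝ × ℝ => p.1) (psi_cont ha) c1
  have p2 : ContinuousAt (fun p : ℝ × ℝ => digamma p.2) (a, b) :=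
    ContinuousAt.comp (f := fun p : ℝ × ℝ => p.2) (psi_cont hb) c2
  have p3 : ContinuousAt (fun p : ℝ × ℝ => digamma (p.1 + p.2)) (a, b) :=
    ContinuousAt.comp (f := fun p : ℝ × ℝ => p.1 + p.2) (psi_cont hab) c3
  have g1 : ContinuousAt (fun p : ℝ × ℝ => Real.Gamma p.1) (a, b) :=
    ContinuousAt.comp (f := fun p : ℝ × ℝ => p.1) (g := Real.Gamma) (gdiff ha).continuousAt c1
  have g2 : ContinuousAt (fun p : ℝ × ℝ => Real.Gamma p.2) (a, b) :=
    ContinuousAt.comp (f := fun p : ℝ × ℝ => p.2) (g := Real.Gamma) (gdiff hb).continuousAt c2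
  have g3 : ContinuousAt (fun p : ℝ × ℝ => Real.Gamma (p.1 + p.2)) (a, b) :=
    ContinuousAt.comp (f := fun p : ℝ × ℝ => p.1 + p.2) (g := Real.Gamma) (gdiff hab).continuousAt c3
  have n1 := Real.Gamma_pos_of_pos ha
  have n2 := Real.Gamma_pos_of_pos hb
  have n3 := Real.Gamma_pos_of_pos hab
  have l := (g3.div (g1.mul g2) (mul_pos n1 n2).ne').log (div_pos n3 (mul_pos n1 n2)).ne'
  unfold f betaKL
  exact (p1.sub p3).neg.add (continuousAt_const.mul
    (((l.sub continuousAt_const).add ((c1.sub continuousAt_const).mul (p1.sub p3))).add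
      ((c2.sub continuousAt_const).mul (p2.sub p3))))

lemma loss_eq (lam a0 b0 μ τ : ℝ) :
    icrmLoss lam a0 b0 μ τ = f lam a0 b0 (μ * τ, (1 - μ) * τ) := by
  unfold icrmLoss f
  simp only
  rw [show μ * τ + (1 - μ) * τ = τ by ring]

lemma f_sub (lam a0 b0 M : ℝ) (hl : 0 < lam) (ha0 : 0 < a0) (hb0 : 0 < b0) :
    ∃ δ > 0, ∃ R, ∀ a b : ℝ, 0 < a → 0 < b → f lam a0 b0 (a, b) ≤ M →
      (a, b) ∈ Icc δ R ×ˢ Icc δ R := by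
  set c := min a0 b0 with hc
  have hcp : 0 < c := lt_min ha0 hb0
  set k := Real.log (Real.Gamma (a0 + b0) / (Real.Gamma a0 * Real.Gamma b0)) with hk
  obtain ⟨δ, hδ, R, h⟩ := coercive c (M / lam + k) hcp
  refine ⟨δ, hδ, R, fun a b ha hb hf => ?_⟩
  have n1 := Real.Gamma_pos_of_pos ha
  have n2 := Real.Gamma_pos_of_pos hb
  have n3 := Real.Gamma_pos_of_pos (add_pos ha hb)
  have da : 0 ≤ digamma (a + b) - digamma a := sub_nonneg.2 (psi_mono ha (by linarith))
  have db : 0 ≤ digamma (a + b) - digamma b := sub_nonneg.2 (psi_mono hb (by linarith))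
  have hKL : betaKL a b a0 b0 = g a + g b - g (a + b) - k
      + a0 * (digamma (a + b) - digamma a) + b0 * (digamma (a + b) - digamma b) := by
    unfold betaKL g lG
    rw [Real.log_div n3.ne' (mul_pos n1 n2).ne', Real.log_mul n1.ne' n2.ne']
    ring
  have h1 : betaKL a b a0 b0 ≤ M / lam := by
    rw [le_div_iff₀ hl]
    simp only [f] at hf
    linarith
  have h2 := mul_le_mul_of_nonneg_right (min_le_left a0 b0) da
  have h3 := mul_le_mul_of_nonneg_right (min_le_right a0 b0) db
  have h4 := mul_nonneg hcp.le da
  have h5 := mul_nonneg hcp.le db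
  rcases le_total a b with hab | hab
  · obtain ⟨h6, h7⟩ := h a b ha hab (by linarith)
    exact ⟨⟨h6, hab.trans h7⟩, ⟨h6.trans hab, h7⟩⟩
  · obtain ⟨h6, h7⟩ := h b a hb hab (by rw [add_comm b a]; linarith)
    exact ⟨⟨h6.trans hab, h7⟩, ⟨h6, hab.trans h7⟩⟩

end ICRM

/-- The ICRM loss is continuous on `(0,1) × (0,∞)` and attains its global minimum
at an interior point `(μ*, τ*)` with `0 < μ* < 1`, `0 < τ* < ∞`. -/
theorem icrm_interior_optimum (lam α₀ β₀ : ℝ)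
    (hlam : 0 < lam) (hα₀ : 0 < α₀) (hβ₀ : 0 < β₀) :
    ContinuousOn (fun p : ℝ × ℝ => icrmLoss lam α₀ β₀ p.1 p.2)
        (Set.Ioo (0:ℝ) 1 ×ˢ Set.Ioi (0:ℝ)) ∧
    ∃ p ∈ Set.Ioo (0:ℝ) 1 ×ˢ Set.Ioi (0:ℝ),
      ∀ q ∈ Set.Ioo (0:ℝ) 1 ×ˢ Set.Ioi (0:ℝ),
        icrmLoss lam α₀ β₀ p.1 p.2 ≤ icrmLoss lam α₀ β₀ q.1 q.2 := by
  have maps : ∀ p ∈ Set.Ioo (0:ℝ) 1 ×ˢ Set.Ioi (0:ℝ),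
      0 < p.1 * p.2 ∧ 0 < (1 - p.1) * p.2 := by
    rintro ⟨μ, τ⟩ ⟨⟨h0, h1⟩, h2⟩
    exact ⟨mul_pos h0 h2, mul_pos (sub_pos.2 h1) h2⟩
  constructor
  · simp only [ICRM.loss_eq]
    exact (ICRM.f_cont lam α₀ β₀).comp (f := fun p : ℝ × ℝ => (p.1 * p.2, (1 - p.1) * p.2))
      (by fun_prop) (fun p hp => maps p hp)
  · obtain ⟨δ, hδ, R, h⟩ :=
      ICRM.f_sub lam α₀ β₀ (ICRM.f lam α₀ β₀ (α₀, β₀)) hlam hα₀ hβ₀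
    have hmem := h α₀ β₀ hα₀ hβ₀ le_rfl
    obtain ⟨⟨a, b⟩, hp, hmin⟩ := (isCompact_Icc.prod isCompact_Icc).exists_isMinOn
      ⟨_, hmem⟩ ((ICRM.f_cont lam α₀ β₀).mono (t := Icc δ R ×ˢ Icc δ R)
        (fun p hp => ⟨hδ.trans_le hp.1.1, hδ.trans_le hp.2.1⟩))
    have ha : 0 < a := hδ.trans_le hp.1.1
    have hb : 0 < b := hδ.trans_le hp.2.1
    have hab : 0 < a + b := add_pos ha hb
    refine ⟨(a / (a + b), a + b), ⟨⟨by positivity, ?_⟩, hab⟩, fun q hq => ?_⟩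
    · rw [div_lt_one hab]; linarith
    simp only [ICRM.loss_eq]
    rw [show a / (a + b) * (a + b) = a by field_simp,
      show (1 - a / (a + b)) * (a + b) = b by field_simp; ring]
    obtain ⟨h1, h2⟩ := maps q hq
    by_cases hle : ICRM.f lam α₀ β₀ (q.1 * q.2, (1 - q.1) * q.2) ≤ ICRM.f lam α₀ β₀ (α₀, β₀)
    · exact hmin (h _ _ h1 h2 hle)
    · exact (hmin hmem).trans (not_le.1 hle).le
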